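/- arXiv:1708.00629 — 3 statements merged into one kernel-verified Lean document; each statement's English description precedes it below -/
import Mathlib

section
/- Let F be an abelian group and σ a normalized 𝕋-valued 2-cocycle on F. Then σσ* is an antisymmetric bicharacter on F: for each p ∈ F the maps q ↦ (σσ*)(p,q) and q ↦ (σσ*)(q,p) are group homomorphisms from F to 𝕋, and (σσ*)(q,p) = conj((σσ*)(p,q)) for all p, q ∈ F. Equivalently, the map p ↦ (σσ*)(p,·) is a group homomorphism from F into the group Hom(F,𝕋) of characters of F; consequently its kernel Z_σ is a subgroup of F. -/
/-- The commutator `(p, q) ↦ σ p q * (σ q p)⁻¹` of a 2-cocycle on an abelian group is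
multiplicative in the second variable. -/
theorem cocycle_commutator_mul_right {F A : Type*} [CommGroup F] [CommGroup A] (σ : F → F → A)
    (h_cocycle : ∀ p q r : F, σ p q * σ (p * q) r = σ q r * σ p (q * r)) (p q r : F) :
    σ p (q * r) * (σ (q * r) p)⁻¹ = (σ p q * (σ q p)⁻¹) * (σ p r * (σ r p)⁻¹) := by
  have h₁ : σ p (q * r) = (σ q r)⁻¹ * (σ p q * σ (p * q) r) :=
    eq_inv_mul_of_mul_eq (h_cocycle p q r).symm
  have h₂ : σ (q * r) p = (σ q r)⁻¹ * (σ r p * σ q (p * r)) := by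
    rw [mul_comm p r]
    exact eq_inv_mul_of_mul_eq (h_cocycle q r p)
  have h₃ : σ (p * q) r = (σ q p)⁻¹ * (σ p r * σ q (p * r)) := by
    rw [mul_comm p q]
    exact eq_inv_mul_of_mul_eq (h_cocycle q p r)
  rw [h₁, h₂, h₃]
  simp only [← div_eq_mul_inv, mul_div_mul_left_eq_div]
  rw [← mul_assoc, ← mul_assoc, mul_assoc (σ p q * _), mul_div_assoc, mul_div_mul_right_eq_div,
    div_eq_mul_inv (σ p q)]

/-- Let `F` be an abelian group and `σ` a normalized `𝕋`-valued 2-cocycle on `F`.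
Then `σσ*`, given by `(σσ*)(p,q) = σ p q * (σ q p)⁻¹` (inversion on the circle is
complex conjugation), is an antisymmetric bicharacter on `F`; equivalently,
`p ↦ (σσ*)(p, ·)` is a group homomorphism `F → Hom(F, 𝕋)`, and consequently its
kernel `Z_σ = {p | ∀ q, (σσ*)(p,q) = 1}` is a subgroup of `F`. -/
theorem sigma_sigma_star_antisymmetric_bicharacter
    {F : Type*} [CommGroup F] (σ : F → F → Circle)
    (h_norm : ∀ p : F, σ 1 p = 1 ∧ σ p 1 = 1)
    (h_cocycle : ∀ p q r : F, σ p q * σ (p * q) r = σ q r * σ p (q * r)) :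
    (∀ p q r : F, σ p (q * r) * (σ (q * r) p)⁻¹
        = (σ p q * (σ q p)⁻¹) * (σ p r * (σ r p)⁻¹)) ∧
    (∀ p q r : F, σ (q * r) p * (σ p (q * r))⁻¹
        = (σ q p * (σ p q)⁻¹) * (σ r p * (σ p r)⁻¹)) ∧
    (∀ p q : F, σ q p * (σ p q)⁻¹ = (σ p q * (σ q p)⁻¹)⁻¹) ∧
    (∃ Φ : F →* (F →* Circle), ∀ p q : F, Φ p q = σ p q * (σ q p)⁻¹) ∧
    (∃ H : Subgroup F, (H : Set F) = {p : F | ∀ q : F, σ p q * (σ q p)⁻¹ = 1}) := by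
  have right := cocycle_commutator_mul_right σ h_cocycle
  have anti : ∀ p q : F, σ q p * (σ p q)⁻¹ = (σ p q * (σ q p)⁻¹)⁻¹ := fun p q => by
    rw [mul_inv_rev, inv_inv]
  have left : ∀ p q r : F, σ (q * r) p * (σ p (q * r))⁻¹
      = (σ q p * (σ p q)⁻¹) * (σ r p * (σ p r)⁻¹) := fun p q r => by
    rw [anti p (q * r), right, mul_inv, ← anti, ← anti]
  let Φ : F →* (F →* Circle) := MonoidHom.mk'
    (fun p => MonoidHom.mk' (fun q => σ p q * (σ q p)⁻¹) (right p))
    (fun p q => MonoidHom.ext fun r => left r p q)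
  refine ⟨right, left, anti, ⟨Φ, fun _ _ => rfl⟩, Φ.ker, ?_⟩
  ext p
  exact MonoidHom.ext_iff
end

section
/- Let t be a positive integer, let F = ℤ^t with standard basis e_1, …, e_t, and let σ be a normalized 𝕋-valued 2-cocycle on F. Define ω : F × F → 𝕋 by ω(m,n) = ∏_{1 ≤ j < i ≤ t} ((σσ*)(e_i,e_j))^{m_i · n_j}; thus ω is a bicharacter with ω(e_i,e_j) = (σσ*)(e_i,e_j) when i > j and ω(e_i,e_j) = 1 when i ≤ j. Then ωω* = σσ*, i.e. ω(m,n)·conj(ω(n,m)) = σ(m,n)·conj(σ(n,m)) for all m, n ∈ ℤ^t; consequently Z_ω = Z_σ. -/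
/-- The `i`-th standard basis vector of `ℤ^t`. -/
def stdBasisZ (t : ℕ) (i : Fin t) : Fin t → ℤ := Pi.single i 1

/-- The antisymmetrization of a 2-cocycle on an abelian group is multiplicative in its first
variable. -/
theorem antisymm_add_left_of_cocycle {G M : Type*} [AddCommGroup G] [CommGroup M]
    {σ : G → G → M} (h : ∀ p q r, σ p q * σ (p + q) r = σ q r * σ p (q + r)) (p q r : G) :
    σ (p + q) r * (σ r (p + q))⁻¹ = σ p r * (σ r p)⁻¹ * (σ q r * (σ r q)⁻¹) := by
  have h₁ : σ (p + q) r = σ q r * σ p (q + r) * (σ p q)⁻¹ := by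
    rw [← h p q r, mul_right_comm, mul_inv_cancel, one_mul]
  have h₂ : σ r (p + q) = σ r p * σ (p + r) q * (σ p q)⁻¹ := by
    rw [add_comm p r, h r p q, mul_right_comm, mul_inv_cancel, one_mul]
  have h₃ : σ p (q + r) = σ p r * σ (p + r) q * (σ r q)⁻¹ := by
    rw [h p r q, add_comm r q, mul_right_comm, mul_inv_cancel, one_mul]
  rw [h₁, h₂, h₃]
  apply Additive.ofMul.injective
  simp only [ofMul_mul, ofMul_inv]
  abel

/-- The antisymmetrization of a 2-cocycle on an abelian group is multiplicative in its second
variable. -/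
theorem antisymm_add_right_of_cocycle {G M : Type*} [AddCommGroup G] [CommGroup M]
    {σ : G → G → M} (h : ∀ p q r, σ p q * σ (p + q) r = σ q r * σ p (q + r)) (p q r : G) :
    σ p (q + r) * (σ (q + r) p)⁻¹ = σ p q * (σ q p)⁻¹ * (σ p r * (σ r p)⁻¹) := by
  have := congrArg (·⁻¹) (antisymm_add_left_of_cocycle h q r p)
  simpa [mul_comm, mul_left_comm, mul_assoc] using this

/-- Two maps from `ℤ^t` turning sums into products agree if they agree on the standard basis. -/
theorem eq_of_map_add_of_stdBasisZ {t : ℕ} {M : Type*} [CommGroup M] {f g : (Fin t → ℤ) → M}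
    (hf : ∀ m n, f (m + n) = f m * f n) (hg : ∀ m n, g (m + n) = g m * g n)
    (h : ∀ i, f (stdBasisZ t i) = g (stdBasisZ t i)) : f = g := by
  let F : (Fin t → ℤ) →+ Additive M := AddMonoidHom.mk' (fun m => Additive.ofMul (f m)) hf
  let G : (Fin t → ℤ) →+ Additive M := AddMonoidHom.mk' (fun m => Additive.ofMul (g m)) hg
  have hFG : F = G := AddMonoidHom.functions_ext' _ _ _ fun i => AddMonoidHom.ext_int (h i)
  exact funext fun m => DFunLike.congr_fun hFG m

/-- Two bimultiplicative maps on `ℤ^t` agree if they agree on pairs of standard basis vectors. -/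
theorem eq_of_map_add_of_stdBasisZ₂ {t : ℕ} {M : Type*} [CommGroup M]
    {f g : (Fin t → ℤ) → (Fin t → ℤ) → M}
    (hf : ∀ m m' n, f (m + m') n = f m n * f m' n) (hf' : ∀ m n n', f m (n + n') = f m n * f m n')
    (hg : ∀ m m' n, g (m + m') n = g m n * g m' n) (hg' : ∀ m n n', g m (n + n') = g m n * g m n')
    (h : ∀ i j, f (stdBasisZ t i) (stdBasisZ t j) = g (stdBasisZ t i) (stdBasisZ t j)) :
    f = g :=
  eq_of_map_add_of_stdBasisZ (fun m m' => funext (hf m m')) (fun m m' => funext (hg m m'))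
    fun i => eq_of_map_add_of_stdBasisZ (hf' _) (hg' _) (h i)

/-- The value on standard basis vectors of the bimultiplicative map `∏ (c i j) ^ (mᵢ nⱼ)` over
`j < i`. -/
theorem prod_zpow_stdBasisZ {t : ℕ} {M : Type*} [CommGroup M] (c : Fin t → Fin t → M)
    (k l : Fin t) :
    ∏ i : Fin t, ∏ j ∈ Finset.univ.filter (fun j => j < i),
      c i j ^ (stdBasisZ t k i * stdBasisZ t l j) = if l < k then c k l else 1 := by
  rw [Finset.prod_eq_single k (fun i _ hi => by simp [stdBasisZ, hi]) (by simp),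
    Finset.prod_filter, Finset.prod_eq_single l (fun j _ hj => by simp [stdBasisZ, hj]) (by simp)]
  simp [stdBasisZ]

/-- Let `t ≥ 1`, `F = ℤ^t` with standard basis `e₁, …, e_t`, and let `σ` be a
normalized `𝕋`-valued 2-cocycle on `F`.  Define
`ω m n = ∏_{j < i} ((σσ*)(eᵢ,eⱼ))^(mᵢ nⱼ)` (inversion on the circle is complex
conjugation).  Then `ω` is a bicharacter with `ω(eᵢ,eⱼ) = (σσ*)(eᵢ,eⱼ)` for
`i > j` and `ω(eᵢ,eⱼ) = 1` for `i ≤ j`, it satisfies `ωω* = σσ*`, and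
consequently `Z_ω = Z_σ`. -/
theorem bicharacter_from_cocycle_on_free_abelian
    (t : ℕ) (ht : 0 < t) (σ : (Fin t → ℤ) → (Fin t → ℤ) → Circle)
    (h_norm : ∀ p : Fin t → ℤ, σ 0 p = 1 ∧ σ p 0 = 1)
    (h_cocycle : ∀ p q r : Fin t → ℤ,
      σ p q * σ (p + q) r = σ q r * σ p (q + r))
    (ω : (Fin t → ℤ) → (Fin t → ℤ) → Circle)
    (hω : ∀ m n : Fin t → ℤ, ω m n =
      ∏ i : Fin t, ∏ j ∈ Finset.univ.filter (fun j => j < i),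
        (σ (stdBasisZ t i) (stdBasisZ t j)
          * (σ (stdBasisZ t j) (stdBasisZ t i))⁻¹) ^ (m i * n j)) :
    (∀ i j : Fin t, j < i → ω (stdBasisZ t i) (stdBasisZ t j)
        = σ (stdBasisZ t i) (stdBasisZ t j)
          * (σ (stdBasisZ t j) (stdBasisZ t i))⁻¹) ∧
    (∀ i j : Fin t, i ≤ j → ω (stdBasisZ t i) (stdBasisZ t j) = 1) ∧
    (∀ m m' n : Fin t → ℤ, ω (m + m') n = ω m n * ω m' n) ∧
    (∀ m n n' : Fin t → ℤ, ω m (n + n') = ω m n * ω m n') ∧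
    (∀ m n : Fin t → ℤ, ω m n * (ω n m)⁻¹ = σ m n * (σ n m)⁻¹) ∧
    {p : Fin t → ℤ | ∀ q : Fin t → ℤ, ω p q * (ω q p)⁻¹ = 1}
      = {p : Fin t → ℤ | ∀ q : Fin t → ℤ, σ p q * (σ q p)⁻¹ = 1} := by
  have hbasis (i j : Fin t) : ω (stdBasisZ t i) (stdBasisZ t j) =
      if j < i then σ (stdBasisZ t i) (stdBasisZ t j)
        * (σ (stdBasisZ t j) (stdBasisZ t i))⁻¹ else 1 := by
    rw [hω]
    exact prod_zpow_stdBasisZ (fun i j => σ (stdBasisZ t i) (stdBasisZ t j)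
      * (σ (stdBasisZ t j) (stdBasisZ t i))⁻¹) i j
  have hadd_left (m m' n : Fin t → ℤ) : ω (m + m') n = ω m n * ω m' n := by
    simp only [hω, Pi.add_apply, add_mul, zpow_add, Finset.prod_mul_distrib]
  have hadd_right (m n n' : Fin t → ℤ) : ω m (n + n') = ω m n * ω m n' := by
    simp only [hω, Pi.add_apply, mul_add, zpow_add, Finset.prod_mul_distrib]
  have hanti : (fun m n => ω m n * (ω n m)⁻¹) = fun m n => σ m n * (σ n m)⁻¹ := by
    refine eq_of_map_add_of_stdBasisZ₂ (fun m m' n => ?_) (fun m n n' => ?_)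
      (antisymm_add_left_of_cocycle h_cocycle) (antisymm_add_right_of_cocycle h_cocycle)
      fun i j => ?_
    · simp only [hadd_left, hadd_right, mul_inv, mul_mul_mul_comm]
    · simp only [hadd_left, hadd_right, mul_inv, mul_mul_mul_comm]
    · rcases lt_trichotomy i j with hij | rfl | hij
      · simp [hbasis, hij, hij.not_gt]
      · simp
      · simp [hbasis, hij, hij.not_gt]
  have hanti' (m n : Fin t → ℤ) : ω m n * (ω n m)⁻¹ = σ m n * (σ n m)⁻¹ :=
    congrFun₂ hanti m n
  refine ⟨fun i j hij => by rw [hbasis, if_pos hij], fun i j hij => by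
    rw [hbasis, if_neg hij.not_gt], hadd_left, hadd_right, hanti', ?_⟩
  simp only [hanti']
end

section
/- Let F be an abelian group (written additively), ω a bicharacter on F, A a unital C*-algebra, and p ↦ W_p a map from F into the unitary group of A satisfying W_p · W_q = ω(p,q) · W_{p+q} for all p, q ∈ F. Suppose moreover that A equals the closed linear span of {W_p : p ∈ F}. If φ and ψ are continuous linear functionals on A with the trace property (φ(ab) = φ(ba) and ψ(ab) = ψ(ba) for all a, b ∈ A) such that φ(W_p) = ψ(W_p) for every p ∈ Z_ω, then φ = ψ. In particular, a tracial state of A is uniquely determined by its values on {W_p : p ∈ Z_ω}. -/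
/-- A tracial functional vanishes at an element which commutes with some unitary only up to
a nontrivial scalar. -/
theorem eq_zero_of_tracial_of_smul_mul_eq {A : Type*} [Ring A] [StarRing A] [Algebra ℂ A]
    (φ : A →ₗ[ℂ] ℂ) (hφ : ∀ a b : A, φ (a * b) = φ (b * a)) {u a : A} (hu : u ∈ unitary A)
    {s t : ℂ} (hst : s ≠ t) (h : s • (u * a) = t • (a * u)) : φ a = 0 := by
  have key : s * φ a = t * φ a := by
    have hconj := congrArg (fun x => φ (x * star u)) h
    simp only [smul_mul_assoc, map_smul, smul_eq_mul] at hconj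
    rwa [hφ (u * a), ← mul_assoc, Unitary.star_mul_self_of_mem hu, one_mul,
      mul_assoc, Unitary.mul_star_self_of_mem hu, mul_one] at hconj
  exact (mul_eq_mul_right_iff.mp key).resolve_left hst


/-- Let `F` be an additive abelian group, `ω` a bicharacter on `F`, `A` a unital
C*-algebra, and `W : F → A` a family of unitaries with
`W p * W q = ω(p,q) • W (p+q)` whose closed linear span is all of `A`.  Then two
continuous tracial linear functionals on `A` that agree on `{W p : p ∈ Z_ω}`
are equal; in particular a tracial state is determined by its values on
`{W p : p ∈ Z_ω}`. -/
theorem tracial_functional_determined_on_centre_of_bicharacter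
    {F : Type*} [AddCommGroup F]
    {A : Type*} [NormedRing A] [StarRing A] [CStarRing A]
    [NormedAlgebra ℂ A] [StarModule ℂ A] [CompleteSpace A]
    (ω : F → F → Circle)
    (hom_right : ∀ p q r : F, ω p (q + r) = ω p q * ω p r)
    (hom_left : ∀ p q r : F, ω (q + r) p = ω q p * ω r p)
    (W : F → A) (hW : ∀ p : F, W p ∈ unitary A)
    (hrel : ∀ p q : F, W p * W q = (ω p q : ℂ) • W (p + q))
    (hspan : (Submodule.span ℂ (Set.range W)).topologicalClosure = ⊤)
    (φ ψ : A →L[ℂ] ℂ)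
    (hφ : ∀ a b : A, φ (a * b) = φ (b * a))
    (hψ : ∀ a b : A, ψ (a * b) = ψ (b * a))
    (hagree : ∀ p : F, (∀ q : F, ω p q * (ω q p)⁻¹ = 1) → φ (W p) = ψ (W p)) :
    φ = ψ := by
  refine ContinuousLinearMap.ext_on
    (Submodule.dense_iff_topologicalClosure_eq_top.mpr hspan) ?_
  rintro _ ⟨p, rfl⟩
  by_cases hp : ∀ q : F, ω p q * (ω q p)⁻¹ = 1
  · exact hagree p hp
  push Not at hp
  obtain ⟨q, hq⟩ := hp
  have hne : (ω p q : ℂ) ≠ ω q p := fun h => hq (mul_inv_eq_one.mpr (Circle.ext h))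
  have hcomm : (ω p q : ℂ) • (W q * W p) = (ω q p : ℂ) • (W p * W q) := by
    rw [hrel, hrel, add_comm q p, smul_comm]
  have hφp := eq_zero_of_tracial_of_smul_mul_eq φ.toLinearMap hφ (hW q) hne hcomm
  have hψp := eq_zero_of_tracial_of_smul_mul_eq ψ.toLinearMap hψ (hW q) hne hcomm
  exact hφp.trans hψp.symm
end
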